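/- arXiv:1703.08879 — 2 statements merged into one kernel-verified Lean document; each statement's English description precedes it below -/
import Mathlib

section
/- Let X be a Polish space. If A ⊆ X has the Baire property, then the annihilator 𝓝(A) has the Baire property as a subset of 𝓜(X). -/
open MeasureTheory Set Topology
open scoped ENNReal symmDiff

/-- The annihilator of a set `A`: the set of Borel probability measures `μ` on `X`
whose induced outer measure vanishes on `A`. -/
def Annihilator {X : Type*} [MeasurableSpace X] (A : Set X) :
    Set (ProbabilityMeasure X) :=
  {μ : ProbabilityMeasure X | μ.toMeasure A = 0}

/-- `A` is residually null if its annihilator is comeager in the space `𝓜(X)` of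
Borel probability measures with the topology of weak convergence. -/
def ResiduallyNull {X : Type*} [TopologicalSpace X] [MeasurableSpace X]
    [OpensMeasurableSpace X] (A : Set X) : Prop :=
  Annihilator A ∈ residual (ProbabilityMeasure X)

/-- A set has the Baire property if its symmetric difference with some open set is meager. -/
def HasBaireProperty {Y : Type*} [TopologicalSpace Y] (S : Set Y) : Prop :=
  ∃ U : Set Y, IsOpen U ∧ IsMeagre (S ∆ U)

/-- Two sets that agree modulo a null set of `μ` are simultaneously `μ`-null. -/
theorem measure_eq_zero_iff_of_symmDiff {X : Type*} [MeasurableSpace X] {μ : Measure X}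
    {A B : Set X} (h : μ (A ∆ B) = 0) : μ A = 0 ↔ μ B = 0 := by
  rw [measure_congr (measure_symmDiff_eq_zero_iff.1 h)]

section

variable {X : Type*} [TopologicalSpace X] [PolishSpace X] [MeasurableSpace X] [BorelSpace X]

theorem isOpen_setOf_measure_lt {F : Set X} (hF : IsClosed F) (ε : ℝ≥0∞) :
    IsOpen {μ : ProbabilityMeasure X | μ.toMeasure F < ε} := by
  let _ := TopologicalSpace.upgradeIsCompletelyMetrizable X
  rw [isOpen_iff_mem_nhds]
  intro μ hμ
  refine Filter.eventually_lt_of_limsup_lt (lt_of_le_of_lt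
    (ProbabilityMeasure.limsup_measure_closed_le_of_tendsto (Filter.tendsto_id) hF) hμ)

theorem isClosed_annihilator {U : Set X} (hU : IsOpen U) : IsClosed (Annihilator U) := by
  let _ := TopologicalSpace.upgradeIsCompletelyMetrizable X
  rw [← isOpen_compl_iff, isOpen_iff_mem_nhds]
  intro μ hμ
  have hpos : 0 < μ.toMeasure U := pos_iff_ne_zero.2 hμ
  filter_upwards [Filter.eventually_lt_of_lt_liminf (lt_of_lt_of_le hpos
    (ProbabilityMeasure.le_liminf_measure_open_of_tendsto Filter.tendsto_id hU))] with ν hν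
  exact hν.ne'

/-- Measures are weak limits of their images under simple functions into the dense set `Fᶜ`. -/
theorem dense_annihilator {F : Set X} (hF : IsClosed F) (hd : Dense Fᶜ) :
    Dense (Annihilator F) := by
  let _ := TopologicalSpace.upgradeIsCompletelyMetrizable X
  intro μ
  have : Nonempty X := μ.toMeasure.nonempty_of_neZero
  obtain ⟨y, hy⟩ := hd.nonempty
  let f : ℕ → SimpleFunc X X := fun n => SimpleFunc.approxOn id measurable_id Fᶜ y hy n
  have hf : ∀ n, Measurable (f n) := fun n => (f n).measurable
  refine mem_closure_of_tendsto (b := Filter.atTop)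
    (f := fun n => μ.map (hf n).aemeasurable) ?_ (Filter.Eventually.of_forall fun n => ?_)
  · rw [ProbabilityMeasure.tendsto_iff_forall_integral_tendsto]
    intro g
    have hmap : ∀ n, ∫ x, g x ∂(μ.map (hf n).aemeasurable : Measure X) = ∫ x, g (f n x) ∂μ :=
      fun n => integral_map (hf n).aemeasurable g.continuous.aestronglyMeasurable
    simp_rw [hmap]
    refine tendsto_integral_of_dominated_convergence (fun _ => ‖g‖)
      (fun n => (g.continuous.measurable.comp (hf n)).aestronglyMeasurable)
      (integrable_const _) (fun n => ae_of_all _ fun x => g.norm_coe_le_norm _)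
      (ae_of_all _ fun x => ?_)
    exact (g.continuous.tendsto x).comp
      (SimpleFunc.tendsto_approxOn measurable_id hy (hd x))
  · change Measure.map (f n) μ.toMeasure F = 0
    rw [Measure.map_apply (hf n) hF.measurableSet]
    have : f n ⁻¹' F = ∅ :=
      eq_empty_of_forall_notMem fun x hx => SimpleFunc.approxOn_mem measurable_id hy n x hx
    rw [this, measure_empty]

theorem annihilator_mem_residual_of_isNowhereDense {F : Set X} (hF : IsNowhereDense F) :
    Annihilator F ∈ residual (ProbabilityMeasure X) := by
  have hd : Dense (closure F)ᶜ := interior_eq_empty_iff_dense_compl.1 hF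
  have hlt : ∀ n : ℕ, {μ : ProbabilityMeasure X | μ.toMeasure (closure F) < (n : ℝ≥0∞)⁻¹} ∈
      residual (ProbabilityMeasure X) := fun n =>
    residual_of_dense_open (isOpen_setOf_measure_lt isClosed_closure _)
      ((dense_annihilator isClosed_closure hd).mono fun μ hμ =>
        (show μ.toMeasure (closure F) = 0 from hμ).trans_lt (by simp))
  filter_upwards [countable_iInter_mem.2 hlt] with μ hμ
  refine measure_mono_null subset_closure (le_antisymm (not_lt.1 fun hpos => ?_) zero_le)
  obtain ⟨n, hn⟩ := ENNReal.exists_inv_nat_lt hpos.ne'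
  exact hn.not_gt (mem_iInter.1 hμ n)

/-- The annihilator of a meager set is comeager. -/
theorem IsMeagre.residuallyNull {A : Set X} (hA : IsMeagre A) : ResiduallyNull A := by
  obtain ⟨S, hS, hSc, hAS⟩ := isMeagre_iff_countable_union_isNowhereDense.1 hA
  filter_upwards [(countable_bInter_mem hSc).2
    fun s hs => annihilator_mem_residual_of_isNowhereDense (hS s hs)] with μ hμ
  refine measure_mono_null hAS ((measure_sUnion_null_iff hSc).2 fun s hs => ?_)
  exact mem_iInter₂.1 hμ s hs

end

/-- If `A` has the Baire property in `X`, then `Annihilator A` has the Baire property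
in `𝓜(X)`. -/
theorem baireProperty_annihilator {X : Type*} [TopologicalSpace X] [PolishSpace X]
    [MeasurableSpace X] [BorelSpace X] (A : Set X) (h : HasBaireProperty A) :
    HasBaireProperty (Annihilator A) := by
  obtain ⟨U, hU, hAU⟩ := h
  have heq : Annihilator A =ᶠ[residual _] Annihilator U := by
    filter_upwards [hAU.residuallyNull] with μ hμ
    exact propext (measure_eq_zero_iff_of_symmDiff hμ)
  obtain ⟨V, hV, hUV⟩ :=
    ((isClosed_annihilator hU).isOpen_compl.baireMeasurableSet.of_compl).residualEq_isOpen
  refine ⟨V, hV, ?_⟩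
  rw [IsMeagre]
  filter_upwards [heq.trans hUV] with μ hμ
  have hiff : μ ∈ Annihilator A ↔ μ ∈ V := iff_of_eq hμ
  simp [hiff]
end

section
/- Let X be a Polish space and let A, B ⊆ X be EBP-sets. If ICR(A) ∩ ICR(B) ≠ ∅, then A ∩ B ≠ ∅. -/
open MeasureTheory Set Topology
open scoped ENNReal symmDiff

/-- `A` is an EBP-set (extended Baire property) if its symmetric difference with some
open set is residually null. -/
def EBPSet {X : Type*} [TopologicalSpace X] [MeasurableSpace X]
    [OpensMeasurableSpace X] (A : Set X) : Prop :=
  ∃ U : Set X, IsOpen U ∧ ResiduallyNull (A ∆ U)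

/-- `ROp A` is the union of all open sets `U` such that `U ∩ A` is residually null. -/
def ROp {X : Type*} [TopologicalSpace X] [MeasurableSpace X]
    [OpensMeasurableSpace X] (A : Set X) : Set X :=
  ⋃₀ {U : Set X | IsOpen U ∧ ResiduallyNull (U ∩ A)}

/-- `CROp A = X \ ROp A`. -/
def CROp {X : Type*} [TopologicalSpace X] [MeasurableSpace X]
    [OpensMeasurableSpace X] (A : Set X) : Set X :=
  (ROp A)ᶜ

/-- A regular space carrying a sequence of increasing open covers is Baire, provided that picking
one member of each cover always cuts out a subset of a compact set. -/
theorem baireSpace_of_monotone_open_covers {Y : Type*} [TopologicalSpace Y] [RegularSpace Y]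
    (O : ℕ → ℕ → Set Y) (hopen : ∀ n k, IsOpen (O n k)) (hmono : ∀ n, Monotone (O n))
    (hcover : ∀ n y, ∃ k, y ∈ O n k)
    (hcompact : ∀ k : ℕ → ℕ, ∃ K, IsCompact K ∧ ∀ y, (∀ n, y ∈ O n (k n)) → y ∈ K) :
    BaireSpace Y := by
  refine ⟨fun f hfo hfd => dense_iff_inter_open.2 fun U hU hUne => ?_⟩
  have step : ∀ (n : ℕ) (V : {V : Set Y // IsOpen V ∧ V.Nonempty}),
      ∃ (W : {V : Set Y // IsOpen V ∧ V.Nonempty}) (k : ℕ),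
        closure W.1 ⊆ V.1 ∩ f n ∧ W.1 ⊆ O n k := by
    rintro n ⟨V, hVo, hVne⟩
    obtain ⟨y, hyV, hyf⟩ := (hfd n).inter_open_nonempty V hVo hVne
    obtain ⟨k, hk⟩ := hcover n y
    obtain ⟨C, hC, hCc, hCs⟩ := exists_mem_nhds_isClosed_subset
      (((hVo.inter (hfo n)).inter (hopen n k)).mem_nhds ⟨⟨hyV, hyf⟩, hk⟩)
    refine ⟨⟨interior C, isOpen_interior, y, mem_interior_iff_mem_nhds.2 hC⟩, k, ?_, ?_⟩
    · exact (closure_minimal interior_subset hCc).trans (hCs.trans inter_subset_left)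
    · exact interior_subset.trans (hCs.trans inter_subset_right)
  choose next index hnext hindex using step
  let V : ℕ → {V : Set Y // IsOpen V ∧ V.Nonempty} :=
    fun n => Nat.rec ⟨U, hU, hUne⟩ (fun n W => next n W) n
  have hsucc (n : ℕ) : closure (V (n + 1)).1 ⊆ (V n).1 ∩ f n := hnext n (V n)
  have hsub (n : ℕ) : (V (n + 1)).1 ⊆ O n (index n (V n)) := hindex n (V n)
  have hanti : Antitone fun n => (V n).1 :=
    antitone_nat_of_succ_le fun n => subset_closure.trans ((hsucc n).trans inter_subset_left)
  choose y hy using fun n => (V n).2.2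
  choose κ hκ using hcover
  obtain ⟨K, hK, hyK⟩ := hcompact fun n =>
    max (index n (V n)) ((Finset.range (n + 1)).sup fun i => κ n (y i))
  have hmem (i : ℕ) : y i ∈ K := by
    refine hyK _ fun n => ?_
    rcases Nat.lt_or_ge n i with hni | hni
    · exact hmono n (le_max_left _ _) (hsub n (hanti hni (hy i)))
    · refine hmono n (le_max_of_le_right ?_) (hκ n (y i))
      exact Finset.le_sup (f := fun i => κ n (y i)) (Finset.mem_range.2 (by lia))
  obtain ⟨z, -, hz⟩ := hK.exists_mapClusterPt (f := Filter.atTop) (u := y)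
    (Filter.tendsto_principal.2 (Filter.Eventually.of_forall hmem))
  have hzV (n : ℕ) : z ∈ (V n).1 ∩ f n := by
    refine hsucc n (hz.mem_closure_of_mem _ ?_)
    rw [Filter.mem_map]
    filter_upwards [Filter.eventually_ge_atTop (n + 1)] with i hi
    exact hanti hi (hy i)
  exact ⟨z, (hzV 0).1, mem_iInter.2 fun n => (hzV n).2⟩

theorem isOpen_setOf_measure_lt_of_isClosed {X : Type*} [TopologicalSpace X] [MeasurableSpace X]
    [OpensMeasurableSpace X] [HasOuterApproxClosed X] {F : Set X} (hF : IsClosed F) (c : ℝ≥0∞) :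
    IsOpen {μ : ProbabilityMeasure X | μ.toMeasure F < c} := by
  refine isOpen_iff_mem_nhds.2 fun μ hμ => ?_
  have hlim : Filter.limsup (fun ν : ProbabilityMeasure X => ν.toMeasure F) (𝓝 μ) < c :=
    (ProbabilityMeasure.limsup_measure_closed_le_of_tendsto Filter.tendsto_id hF).trans_lt hμ
  exact Filter.eventually_lt_of_limsup_lt hlim

theorem baireSpace_probabilityMeasure (X : Type*) [TopologicalSpace X] [PolishSpace X]
    [MeasurableSpace X] [BorelSpace X] [Nonempty X] : BaireSpace (ProbabilityMeasure X) := by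
  let := TopologicalSpace.upgradeIsCompletelyMetrizable X
  obtain ⟨D, hD⟩ := TopologicalSpace.exists_dense_seq X
  let r (n : ℕ) : ℝ := (2⁻¹ : ℝ) ^ n
  have hr (n : ℕ) : 0 < r n := by positivity
  let B (n k : ℕ) : Set X := ⋃ i ∈ Iic k, Metric.ball (D i) (r n)
  let C (n k : ℕ) : Set X := ⋃ i ∈ Iic k, Metric.closedBall (D i) (r n)
  have hB (n k : ℕ) : IsOpen (B n k) := isOpen_biUnion fun _ _ => Metric.isOpen_ball
  have hBC (n k : ℕ) : B n k ⊆ C n k :=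
    biUnion_mono subset_rfl fun _ _ => Metric.ball_subset_closedBall
  have hC (n k : ℕ) : IsClosed (C n k) :=
    (finite_Iic k).isClosed_biUnion fun _ _ => Metric.isClosed_closedBall
  have hBmono (n : ℕ) : Monotone (B n) := fun k l hkl =>
    biUnion_subset_biUnion_left (Iic_subset_Iic.2 hkl)
  have hBcover (n : ℕ) : ⋃ k, B n k = univ := by
    refine eq_univ_of_forall fun x => ?_
    obtain ⟨i, hi⟩ := Metric.denseRange_iff.1 hD x (r n) (hr n)
    exact mem_iUnion.2 ⟨i, mem_biUnion (mem_Iic.2 le_rfl) hi⟩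
  refine baireSpace_of_monotone_open_covers
    (fun n k => {μ : ProbabilityMeasure X | μ.toMeasure (B n k)ᶜ < (2⁻¹ : ℝ≥0∞) ^ n})
    (fun n k => isOpen_setOf_measure_lt_of_isClosed (hB n k).isClosed_compl _)
    (fun n k l hkl μ hμ =>
      (measure_mono (compl_subset_compl.2 (hBmono n hkl))).trans_lt hμ) ?_ ?_
  · intro n μ
    have hlim : Filter.Tendsto (fun k => μ.toMeasure (B n k)ᶜ) Filter.atTop
        (𝓝 (μ.toMeasure (⋂ k, (B n k)ᶜ))) :=
      tendsto_measure_iInter_atTop (fun k => (hB n k).measurableSet.compl.nullMeasurableSet)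
        (fun k l hkl => compl_subset_compl.2 (hBmono n hkl)) ⟨0, measure_ne_top _ _⟩
    rw [← compl_iUnion, hBcover, compl_univ, measure_empty] at hlim
    exact (hlim.eventually_lt_const (ENNReal.pow_pos (by simp) n)).exists
  · intro k
    let K (j : ℕ) : Set X := ⋂ m, C (j + m) (k (j + m))
    have hK (j : ℕ) : IsCompact (K j) := by
      refine TotallyBounded.isCompact_of_isClosed (Metric.totallyBounded_iff.2 fun δ hδ => ?_)
        (isClosed_iInter fun m => hC _ _)
      obtain ⟨m, hm⟩ := exists_pow_lt_of_lt_one hδ (by norm_num : (2⁻¹ : ℝ) < 1)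
      have hlt : r (j + m) < δ :=
        (pow_le_pow_of_le_one (by norm_num) (by norm_num) (Nat.le_add_left m j)).trans_lt hm
      refine ⟨D '' Iic (k (j + m)), (finite_Iic _).image _, ?_⟩
      rw [biUnion_image]
      exact (iInter_subset _ m).trans
        (biUnion_mono subset_rfl fun _ _ => Metric.closedBall_subset_ball hlt)
    have hu : Filter.Tendsto (fun j : ℕ => (2⁻¹ : NNReal) ^ j * 2) Filter.atTop (𝓝 0) := by
      have h := (tendsto_pow_atTop_nhds_zero_of_lt_one (r := (2⁻¹ : NNReal)) zero_le
        (by rw [← NNReal.coe_lt_coe]; norm_num)).mul_const 2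
      rwa [zero_mul] at h
    refine ⟨_, isCompact_setOfPred_probabilityMeasure_mass_eq_compl_isCompact_le hu hK
      (Or.inl inferInstance), fun μ hμ j => ?_⟩
    rw [← ENNReal.coe_le_coe, ProbabilityMeasure.ennreal_coeFn_eq_coeFn_toMeasure]
    calc
      μ.toMeasure (K j)ᶜ = μ.toMeasure (⋃ m, (C (j + m) (k (j + m)))ᶜ) := by
        rw [compl_iInter]
      _ ≤ ∑' m, μ.toMeasure (C (j + m) (k (j + m)))ᶜ := measure_iUnion_le _
      _ ≤ ∑' m, (2⁻¹ : ℝ≥0∞) ^ (j + m) := ENNReal.tsum_le_tsum fun m =>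
        (measure_mono (compl_subset_compl.2 (hBC _ _))).trans (hμ (j + m)).le
      _ = ((2⁻¹ : NNReal) ^ j * 2 : NNReal) := by
        simp_rw [pow_add]
        rw [ENNReal.tsum_mul_left, ENNReal.tsum_geometric, ENNReal.one_sub_inv_two, inv_inv]
        push_cast
        rfl

theorem ResiduallyNull.mono {X : Type*} [TopologicalSpace X] [MeasurableSpace X]
    [OpensMeasurableSpace X] {A B : Set X} (hB : ResiduallyNull B) (hAB : A ⊆ B) :
    ResiduallyNull A :=
  Filter.mem_of_superset hB fun _ hμ => measure_mono_null hAB hμ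

theorem ResiduallyNull.union {X : Type*} [TopologicalSpace X] [MeasurableSpace X]
    [OpensMeasurableSpace X] {A B : Set X} (hA : ResiduallyNull A) (hB : ResiduallyNull B) :
    ResiduallyNull (A ∪ B) :=
  Filter.mem_of_superset (Filter.inter_mem hA hB) fun _ hμ => measure_union_null hμ.1 hμ.2

theorem IsOpen.not_residuallyNull {X : Type*} [TopologicalSpace X] [PolishSpace X]
    [MeasurableSpace X] [BorelSpace X] {O : Set X} (hO : IsOpen O) (hne : O.Nonempty) :
    ¬ ResiduallyNull O := by
  intro hnull
  obtain ⟨x, hx⟩ := hne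
  have : Nonempty X := ⟨x⟩
  have := baireSpace_probabilityMeasure X
  let := TopologicalSpace.upgradeIsCompletelyMetrizable X
  have hdirac : (diracProba x).toMeasure Oᶜ < 1 := by
    simp [diracProba, hO.measurableSet.compl, hx]
  obtain ⟨μ, hμ, hμO⟩ := (dense_of_mem_residual hnull).inter_open_nonempty _
    (isOpen_setOf_measure_lt_of_isClosed hO.isClosed_compl 1) ⟨diracProba x, hdirac⟩
  have hμ' : μ.toMeasure Oᶜ < 1 := hμ
  have hμO' : μ.toMeasure O = 0 := hμO
  rw [(prob_compl_eq_one_iff hO.measurableSet).2 hμO'] at hμ'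
  exact hμ'.false

/-- Inside `CROp A`, every nonempty open set meets any open set equal to `A` up to a residually
null set. -/
theorem inter_nonempty_of_subset_crOp {X : Type*} [TopologicalSpace X] [MeasurableSpace X]
    [OpensMeasurableSpace X] {A U O : Set X} (hAU : ResiduallyNull (A ∆ U)) (hO : IsOpen O)
    (hne : O.Nonempty) (hsub : O ⊆ CROp A) : (O ∩ U).Nonempty := by
  by_contra hempty
  obtain ⟨x, hx⟩ := hne
  refine hsub hx (mem_sUnion.2 ⟨O, ⟨hO, hAU.mono ?_⟩, hx⟩)
  exact fun y hy => Or.inl ⟨hy.2, fun hyU => hempty ⟨y, hy.1, hyU⟩⟩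

/-- If `A` and `B` are EBP-sets and `ICR(A) ∩ ICR(B) ≠ ∅`, then `A ∩ B ≠ ∅`. -/
theorem icr_inter_nonempty {X : Type*} [TopologicalSpace X] [PolishSpace X]
    [MeasurableSpace X] [BorelSpace X] (A B : Set X) (hA : EBPSet A) (hB : EBPSet B)
    (h : (interior (CROp A) ∩ interior (CROp B)).Nonempty) :
    (A ∩ B).Nonempty := by
  obtain ⟨U, hU, hAU⟩ := hA
  obtain ⟨V, hV, hBV⟩ := hB
  have hW : IsOpen (interior (CROp A) ∩ interior (CROp B)) := isOpen_interior.inter isOpen_interior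
  have hne := inter_nonempty_of_subset_crOp hAU hW h (inter_subset_left.trans interior_subset)
  have hne' := inter_nonempty_of_subset_crOp hBV (hW.inter hU) hne
    (inter_subset_left.trans (inter_subset_right.trans interior_subset))
  by_contra hempty
  refine ((hW.inter hU).inter hV).not_residuallyNull hne' ((hAU.union hBV).mono ?_)
  rintro y ⟨⟨-, hyU⟩, hyV⟩
  by_cases hyA : y ∈ A
  · exact Or.inr (Or.inr ⟨hyV, fun hyB => hempty ⟨y, hyA, hyB⟩⟩)
  · exact Or.inl (Or.inr ⟨hyU, hyA⟩)
end
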